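/- Let d be a natural number. The polynomials p_{d,0}, p_{d,1}, ..., p_{d,d} form a basis of the complex vector space of polynomials of degree at most d: for every polynomial f over ℂ with deg f ≤ d there exist unique complex numbers h_0, h_1, ..., h_d such that f(t) = ∑_{j=0}^{d} h_j · p_{d,j}(t). -/

import Mathlib

/-- The basis polynomial `p_{d,j}(t) = binom(t+d-j, d)`, i.e. the descending factorial
`(t+d-j)(t+d-j-1)⋯(t-j+1)` divided by `d!`, evaluated at a complex number. -/
noncomputable def ehrhartBasis (d j : ℕ) (z : ℂ) : ℂ :=
  (∏ i ∈ Finset.range d, (z + d - j - i)) / (d.factorial : ℂ)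

open Polynomial in
/-- The polynomial whose evaluation is `ehrhartBasis d j`. -/
noncomputable def ehrhartBasisPoly (d j : ℕ) : ℂ[X] :=
  C ((d.factorial : ℂ)⁻¹) * ∏ i ∈ Finset.range d, (X + C ((d : ℂ) - j - i))

theorem eval_ehrhartBasisPoly (d j : ℕ) (z : ℂ) :
    (ehrhartBasisPoly d j).eval z = ehrhartBasis d j z := by
  simp only [ehrhartBasisPoly, ehrhartBasis, Polynomial.eval_mul, Polynomial.eval_C,
    Polynomial.eval_prod, Polynomial.eval_add, Polynomial.eval_X, div_eq_inv_mul]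
  congr 1
  exact Finset.prod_congr rfl fun i _ => by ring

theorem degree_ehrhartBasisPoly_le (d j : ℕ) : (ehrhartBasisPoly d j).degree ≤ d := by
  refine Polynomial.degree_le_of_natDegree_le ?_
  refine (Polynomial.natDegree_C_mul_le _ _).trans ?_
  refine (Polynomial.natDegree_prod_le _ _).trans ?_
  simp only [Polynomial.natDegree_X_add_C]
  simp

theorem ehrhartBasis_natCast_eq_zero {d j k : ℕ} (hj : j ≤ d) (hk : k < j) :
    ehrhartBasis d j k = 0 := by
  have hmem : k + d - j ∈ Finset.range d := Finset.mem_range.2 (by omega)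
  rw [ehrhartBasis, Finset.prod_eq_zero hmem, zero_div]
  rw [Nat.cast_sub (by omega)]
  push_cast
  ring

theorem ehrhartBasis_self (d j : ℕ) : ehrhartBasis d j j = 1 := by
  have hprod : ∏ i ∈ Finset.range d, ((j : ℂ) + d - j - i) = d.factorial := by
    rw [← Nat.descFactorial_self, Nat.descFactorial_eq_prod_range, Nat.cast_prod]
    refine Finset.prod_congr rfl fun i hi => ?_
    rw [Nat.cast_sub (Finset.mem_range.1 hi).le]
    ring
  rw [ehrhartBasis, hprod, div_self (Nat.cast_ne_zero.2 d.factorial_ne_zero)]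

/-- The values of the polynomials `p_{d,j}` at the nodes `0, …, d`. -/
noncomputable def ehrhartMatrix (d : ℕ) : Matrix (Fin (d + 1)) (Fin (d + 1)) ℂ :=
  Matrix.of fun k j => ehrhartBasis d j (k : ℕ)

theorem det_ehrhartMatrix (d : ℕ) : (ehrhartMatrix d).det = 1 := by
  rw [Matrix.det_of_isLowerTriangular]
  · simp [ehrhartMatrix, ehrhartBasis_self]
  · intro k j hkj
    exact ehrhartBasis_natCast_eq_zero (Nat.lt_succ_iff.1 j.2) hkj

/-- Polynomials of degree at most `d` agreeing at `0, …, d` are equal, so an expansion in the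
polynomials `p_{d,j}` amounts to a linear system with matrix `ehrhartMatrix d`. -/
theorem eval_eq_sum_ehrhartBasis_iff {d : ℕ} {f : Polynomial ℂ} (hf : f.degree ≤ d)
    (h : Fin (d + 1) → ℂ) :
    (∀ z : ℂ, f.eval z = ∑ j : Fin (d + 1), h j * ehrhartBasis d (j : ℕ) z) ↔
      (ehrhartMatrix d).mulVec h = fun k : Fin (d + 1) => f.eval ((k : ℕ) : ℂ) := by
  have hmul (k : Fin (d + 1)) : (ehrhartMatrix d).mulVec h k =
      ∑ j : Fin (d + 1), h j * ehrhartBasis d (j : ℕ) (k : ℕ) := by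
    simp [Matrix.mulVec, dotProduct, ehrhartMatrix, mul_comm]
  refine ⟨fun H => funext fun k => by rw [hmul, H], fun H => ?_⟩
  set q : Polynomial ℂ := ∑ j : Fin (d + 1), Polynomial.C (h j) * ehrhartBasisPoly d j with hq
  have heval (z : ℂ) : q.eval z = ∑ j : Fin (d + 1), h j * ehrhartBasis d (j : ℕ) z := by
    simp [hq, Polynomial.eval_finsetSum, eval_ehrhartBasisPoly]
  have hqdeg : q.degree ≤ d := by
    refine (Polynomial.degree_sum_le _ _).trans (Finset.sup_le fun j _ => ?_)
    rw [← Polynomial.smul_eq_C_mul]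
    exact (Polynomial.degree_smul_le _ _).trans (degree_ehrhartBasisPoly_le d j)
  have hlt : (d : WithBot ℕ) < (Finset.univ : Finset (Fin (d + 1))).card := by
    rw [Finset.card_fin]
    exact_mod_cast d.lt_succ_self
  have hfq : f = q := by
    refine Polynomial.eq_of_degrees_lt_of_eval_index_eq (v := fun k : Fin (d + 1) => ((k : ℕ) : ℂ))
      Finset.univ (fun a _ b _ hab => Fin.ext (Nat.cast_injective hab))
      (hf.trans_lt hlt) (hqdeg.trans_lt hlt) fun k _ => ?_
    rw [heval, ← hmul, H]
  intro z
  rw [← heval, hfq]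

theorem stmt_8 (d : ℕ) (f : Polynomial ℂ) (hf : f.degree ≤ d) :
    ∃! h : Fin (d + 1) → ℂ,
      ∀ z : ℂ, f.eval z = ∑ j : Fin (d + 1), h j * ehrhartBasis d (j : ℕ) z := by
  simp only [eval_eq_sum_ehrhartBasis_iff hf]
  have hunit : IsUnit (ehrhartMatrix d) := by
    rw [Matrix.isUnit_iff_isUnit_det, det_ehrhartMatrix]
    exact isUnit_one
  exact Function.Bijective.existsUnique
    ⟨Matrix.mulVec_injective_iff_isUnit.2 hunit, Matrix.mulVec_surjective_iff_isUnit.2 hunit⟩ _
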